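/- Let X be a centered d-dimensional Gaussian random vector with non-singular covariance matrix \Sigma and let c \in R^d have at least one positive component, with I the index set (of cardinality m) determined by \Pi_\Sigma(c). Let x(u), u > 0, be d-dimensional vectors with x(u)/u \to 0 as u \to \infty. Then P(X_I > (c u + x(u))_I) \sim u^{-m} \varphi_{X_I}((c u + x(u))_I) / \prod_{i \in I} c_I^T (\Sigma_{II})^{-1} e_i as u \to \infty, where \varphi_{X_I} is the probability density function of X_I and e_i is the i-th unit coordinate vector. -/

import Mathlib

open MeasureTheory ProbabilityTheory Filter Matrix
open scoped Topology ENNReal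

noncomputable section

/-- Submatrix of `A` keeping rows with indices in `I` and columns with indices in `J`. -/
def subM {ι : Type*} (A : Matrix ι ι ℝ) (I J : Finset ι) : Matrix ↥I ↥J ℝ :=
  fun i j => A i j

/-- Subvector of `c` keeping the entries with indices in `I`. -/
def subV {ι : Type*} (c : ι → ℝ) (I : Finset ι) : ↥I → ℝ := fun i => c i

/-- Density of a centered Gaussian vector with covariance matrix `S`. -/
def gaussPDF {ι : Type*} [Fintype ι] [DecidableEq ι] (S : Matrix ι ι ℝ) (x : ι → ℝ) : ℝ :=
  (Real.sqrt ((2 * Real.pi) ^ Fintype.card ι * S.det))⁻¹ *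
    Real.exp (-(x ⬝ᵥ S⁻¹.mulVec x) / 2)

/-- `X` is, under `P`, a centered Gaussian random vector with covariance matrix `S`. -/
def IsCenteredGaussianRV {Ω ι : Type*} [MeasurableSpace Ω] [Fintype ι] [DecidableEq ι]
    (P : Measure Ω) (X : Ω → ι → ℝ) (S : Matrix ι ι ℝ) : Prop :=
  Measure.map X P =
    (volume : Measure (ι → ℝ)).withDensity fun x => ENNReal.ofReal (gaussPDF S x)

/-- `bt` is a solution of the quadratic programming problem `Π_A(c)`:
minimise `x ⬝ Σ⁻¹ x` under `x ≥ c`. -/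
def IsQPSol {ι : Type*} [Fintype ι] [DecidableEq ι] (A : Matrix ι ι ℝ) (c bt : ι → ℝ) : Prop :=
  (∀ i, c i ≤ bt i) ∧
    ∀ x : ι → ℝ, (∀ i, c i ≤ x i) → bt ⬝ᵥ A⁻¹.mulVec bt ≤ x ⬝ᵥ A⁻¹.mulVec x

/-- `I` is the index set determined by the quadratic programming problem `Π_A(c)`
with solution `bt`. -/
def IsQPIndex {ι : Type*} [Fintype ι] [DecidableEq ι] (A : Matrix ι ι ℝ)
    (c bt : ι → ℝ) (I : Finset ι) : Prop :=
  I.Nonempty ∧ (∀ i ∈ I, bt i = c i) ∧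
    (∀ i : ↥I, 0 < (subM A I I)⁻¹.mulVec (subV c I) i) ∧
    ∀ j : ι, j ∉ I → bt j = (fun i : ↥I => A j i) ⬝ᵥ (subM A I I)⁻¹.mulVec (subV c I)

/-- `Σ_{i₀,I} (Σ_{II})⁻¹ c_I`. -/
def rowDot {ι : Type*} [Fintype ι] [DecidableEq ι] (A : Matrix ι ι ℝ) (c : ι → ℝ)
    (I : Finset ι) (i0 : ι) : ℝ :=
  (fun i : ↥I => A i0 i) ⬝ᵥ (subM A I I)⁻¹.mulVec (subV c I)

/-- `c_I ⬝ (Σ_{II})⁻¹ e_{i₀}`. -/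
def eDot {ι : Type*} [Fintype ι] [DecidableEq ι] (A : Matrix ι ι ℝ) (c : ι → ℝ)
    (I : Finset ι) (i0 : ι) : ℝ :=
  subV c I ⬝ᵥ (subM A I I)⁻¹.mulVec fun j : ↥I => if (j : ι) = i0 then 1 else 0

/-- Schur complement `Σ_{I^cI^c} - Σ_{I^cI}(Σ_{II})⁻¹Σ_{II^c}`, the covariance matrix of the
conditional Gaussian distribution of `X_{I^c}` given `X_I`. -/
def schurC {ι : Type*} [Fintype ι] [DecidableEq ι] (A : Matrix ι ι ℝ) (I : Finset ι) :
    Matrix ↥Iᶜ ↥Iᶜ ℝ :=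
  subM A Iᶜ Iᶜ - subM A Iᶜ I * (subM A I I)⁻¹ * subM A I Iᶜ

/-- The conditional law of `X_{I^c}` given `X_I = 0`. -/
def condNu {ι : Type*} [Fintype ι] [DecidableEq ι] (A : Matrix ι ι ℝ) (I : Finset ι) :
    Measure (↥Iᶜ → ℝ) :=
  (volume : Measure (↥Iᶜ → ℝ)).withDensity fun y => ENNReal.ofReal (gaussPDF (schurC A I) y)

/-- Survival function `Ḡ(x) = P(X_{i₀} > x, X_{N*} > 0 | X_I = 0) / P(X_{N*} > 0 | X_I = 0)`. -/
def Gbar {ι : Type*} [Fintype ι] [DecidableEq ι] (A : Matrix ι ι ℝ) (I Nstar : Finset ι)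
    (i0 : ι) (x : ℝ) : ℝ :=
  (condNu A I {y : ↥Iᶜ → ℝ | (∀ j : ↥Iᶜ, (j : ι) = i0 → x < y j) ∧
      ∀ j : ↥Iᶜ, (j : ι) ∈ Nstar → 0 < y j}).toReal /
    (condNu A I {y : ↥Iᶜ → ℝ | ∀ j : ↥Iᶜ, (j : ι) ∈ Nstar → 0 < y j}).toReal

/-- `E[(Y - μ)₊]` where `Y` has survival function `Gbar A I Nstar i0`. -/
def condPlusMean {ι : Type*} [Fintype ι] [DecidableEq ι] (A : Matrix ι ι ℝ)
    (I Nstar : Finset ι) (i0 : ι) (μ : ℝ) : ℝ :=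
  (∫ y in {y : ↥Iᶜ → ℝ | ∀ j : ↥Iᶜ, (j : ι) ∈ Nstar → 0 < y j},
      max ((∑ j : ↥Iᶜ, if (j : ι) = i0 then y j else 0) - μ) 0 ∂(condNu A I)) /
    (condNu A I {y : ↥Iᶜ → ℝ | ∀ j : ↥Iᶜ, (j : ι) ∈ Nstar → 0 < y j}).toReal

/-- `E[Y]` where `Y` has survival function `Gbar A I Nstar i0`. -/
def condMean {ι : Type*} [Fintype ι] [DecidableEq ι] (A : Matrix ι ι ℝ)
    (I Nstar : Finset ι) (i0 : ι) : ℝ :=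
  (∫ y in {y : ↥Iᶜ → ℝ | ∀ j : ↥Iᶜ, (j : ι) ∈ Nstar → 0 < y j},
      (∑ j : ↥Iᶜ, if (j : ι) = i0 then y j else 0) ∂(condNu A I)) /
    (condNu A I {y : ↥Iᶜ → ℝ | ∀ j : ↥Iᶜ, (j : ι) ∈ Nstar → 0 < y j}).toReal

/-- The conditioning event `{X_2 > c_2 u, ..., X_d > c_d u}`. -/
def tailEvent {Ω : Type*} {d : ℕ} [NeZero d] (X : Ω → Fin d → ℝ) (c : Fin d → ℝ) (u : ℝ) :
    Set Ω := {ω | ∀ i : Fin d, i ≠ 0 → c i * u < X ω i}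

/-- The marginal mean excess `E(c,u) = E[(X_1 - c_1 u - μ)₊ | X_2 > c_2 u, ..., X_d > c_d u]`. -/
def mmeV {Ω : Type*} [MeasurableSpace Ω] {d : ℕ} [NeZero d] (P : Measure Ω)
    (X : Ω → Fin d → ℝ) (c : Fin d → ℝ) (μ u : ℝ) : ℝ :=
  (∫ ω in tailEvent X c u, max (X ω 0 - c 0 * u - μ) 0 ∂P) / (P (tailEvent X c u)).toReal

/-- The marginal expected shortfall `S(c,u) = E[X_1 | X_2 > c_2 u, ..., X_d > c_d u]`. -/
def mesV {Ω : Type*} [MeasurableSpace Ω] {d : ℕ} [NeZero d] (P : Measure Ω)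
    (X : Ω → Fin d → ℝ) (c : Fin d → ℝ) (u : ℝ) : ℝ :=
  (∫ ω in tailEvent X c u, X ω 0 ∂P) / (P (tailEvent X c u)).toReal

/-- The multivariate conditional tail expectation `M(c,u) = E[X_1 | X > c u]`. -/
def mcteV {Ω : Type*} [MeasurableSpace Ω] {d : ℕ} [NeZero d] (P : Measure Ω)
    (X : Ω → Fin d → ℝ) (c : Fin d → ℝ) (u : ℝ) : ℝ :=
  (∫ ω in {ω | ∀ i, c i * u < X ω i}, X ω 0 ∂P) / (P {ω | ∀ i, c i * u < X ω i}).toReal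

/-- The index set `{2,...,d}` of the components of `X_{-1}`. -/
def offFirst (d : ℕ) [NeZero d] : Finset (Fin d) := Finset.univ.filter fun i => i ≠ 0

lemma gta_posDef_factor {ι : Type*} [Fintype ι] [DecidableEq ι] (S : Matrix ι ι ℝ)
    (hS : S.PosDef) : ∃ M : Matrix ι ι ℝ, S = M * Mᵀ ∧ M.det ≠ 0 := by
  have hh := hS.1.spectral_theorem
  set U : Matrix ι ι ℝ := (hS.1.eigenvectorUnitary : Matrix ι ι ℝ) with hU
  set ev := hS.1.eigenvalues with hev
  have hpos : ∀ i, 0 < ev i := fun i => hS.eigenvalues_pos i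
  have h1 : S = U * Matrix.diagonal ev * Uᵀ := by
    simpa [Unitary.conjStarAlgAut_apply, Matrix.star_eq_conjTranspose, ← hU, Function.comp_def, ← hev] using hh
  have h2 : S = (U * Matrix.diagonal (fun i => √(ev i))) *
      (U * Matrix.diagonal (fun i => √(ev i)))ᵀ := by
    rw [Matrix.transpose_mul, Matrix.diagonal_transpose, Matrix.mul_assoc U, ← Matrix.mul_assoc _ _ Uᵀ,
      Matrix.diagonal_mul_diagonal]
    simp_rw [fun i => Real.mul_self_sqrt (hpos i).le]
    rw [← Matrix.mul_assoc]; exact h1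
  refine ⟨_, h2, fun h0 => ?_⟩
  have := hS.det_pos
  rw [h2, Matrix.det_mul, h0] at this
  simp at this

lemma gta_std (ι : Type*) [Fintype ι] :
    ∫⁻ y : ι → ℝ, ENNReal.ofReal (Real.exp (-(y ⬝ᵥ y) / 2)) =
      ENNReal.ofReal (√(2 * Real.pi) ^ Fintype.card ι) := by
  have he : ∀ y : ι → ℝ, Real.exp (-(y ⬝ᵥ y) / 2) = ∏ i, Real.exp (-(1/2) * (y i) ^ 2) := by
    intro y
    rw [← Real.exp_sum]
    congr 1
    simp only [dotProduct]
    rw [← Finset.sum_neg_distrib, Finset.sum_div]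
    exact Finset.sum_congr rfl fun i _ => by ring
  simp_rw [he]
  have hi : Integrable (fun y : ι → ℝ => ∏ i, Real.exp (-(1/2) * (y i) ^ 2)) := by
    have := Integrable.fintype_prod (ι := ι) (𝕜 := ℝ) (f := fun _ x => Real.exp (-(1/2) * x ^ 2))
      (μ := fun _ => (volume : Measure ℝ)) (fun _ => integrable_exp_neg_mul_sq (by norm_num))
    exact this
  rw [← ofReal_integral_eq_lintegral_ofReal hi (Eventually.of_forall fun y => by positivity)]
  rw [integral_fintype_prod_volume_eq_pow (fun x : ℝ => Real.exp (-(1/2) * x ^ 2)), integral_gaussian]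
  congr 3
  ring

lemma gta_quad_cont {ι : Type*} [Fintype ι] (S : Matrix ι ι ℝ) :
    Continuous fun x : ι → ℝ => x ⬝ᵥ S.mulVec x :=
  Continuous.dotProduct continuous_id (Continuous.matrix_mulVec continuous_const continuous_id)

lemma gta_pdf_cont {ι : Type*} [Fintype ι] [DecidableEq ι] (S : Matrix ι ι ℝ) :
    Continuous (gaussPDF S) := by
  unfold gaussPDF
  have := gta_quad_cont S⁻¹
  fun_prop

lemma gta_norm {ι : Type*} [Fintype ι] [DecidableEq ι] (S : Matrix ι ι ℝ)
    (hS : S.PosDef) : ∫⁻ x : ι → ℝ, ENNReal.ofReal (gaussPDF S x) = 1 := by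
  obtain ⟨M, hM, hdet⟩ := gta_posDef_factor S hS
  have hmap := Real.map_matrix_volume_pi_eq_smul_volume_pi hdet
  have hmeas : Measurable fun x => ENNReal.ofReal (gaussPDF S x) :=
    (gta_pdf_cont S).measurable.ennreal_ofReal
  have hL : Measurable (Matrix.toLin' M) := 
    (LinearMap.continuous_of_finiteDimensional (Matrix.toLin' M)).measurable
  have key := lintegral_map (μ := volume) hmeas hL
  rw [hmap, lintegral_smul_measure] at key
  have hf : ∀ y, gaussPDF S (Matrix.toLin' M y) = 
      (√((2 * Real.pi) ^ Fintype.card ι * S.det))⁻¹ * Real.exp (-(y ⬝ᵥ y) / 2) := by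
    intro y
    unfold gaussPDF
    congr 3
    have hu : IsUnit M.det := hdet.isUnit
    have hut : IsUnit Mᵀ.det := by rwa [Matrix.det_transpose]
    rw [hM, Matrix.mul_inv_rev, Matrix.toLin'_apply, Matrix.mulVec_mulVec, Matrix.mul_assoc,
      Matrix.nonsing_inv_mul _ hu, Matrix.mul_one, Matrix.dotProduct_mulVec, ← Matrix.mulVec_transpose,
      Matrix.mulVec_mulVec, Matrix.transpose_nonsing_inv, Matrix.transpose_transpose, Matrix.nonsing_inv_mul _ hu,
      Matrix.one_mulVec]
  have hsqrt : √((2 * Real.pi) ^ Fintype.card ι * S.det) = √(2 * Real.pi) ^ Fintype.card ι * |M.det| := by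
    rw [Real.sqrt_mul (by positivity), hM, Matrix.det_mul, Matrix.det_transpose, Real.sqrt_mul_self_eq_abs]
    congr 1
    rw [Real.sqrt_eq_iff_eq_sq (by positivity) (by positivity), ← pow_mul, mul_comm _ 2, pow_mul, Real.sq_sqrt (by positivity)]
  have hp : 0 < |M.det| := abs_pos.2 hdet
  have h2p : 0 < √(2 * Real.pi) := by positivity
  simp_rw [hf] at key
  rw [hsqrt] at key
  simp_rw [ENNReal.ofReal_mul (inv_nonneg.2 (by positivity : 0 ≤ √(2 * Real.pi) ^ Fintype.card ι * |M.det|))] at key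
  rw [lintegral_const_mul' _ _ ENNReal.ofReal_ne_top, gta_std, ← ENNReal.ofReal_mul (by positivity), abs_inv] at key
  have h3 : (√(2 * Real.pi) ^ Fintype.card ι * |M.det|)⁻¹ * √(2 * Real.pi) ^ Fintype.card ι = |M.det|⁻¹ := by
    field_simp
  rw [h3] at key
  have hne : ENNReal.ofReal |M.det|⁻¹ ≠ 0 := by simpa using hdet
  have := (ENNReal.mul_right_inj hne ENNReal.ofReal_ne_top).1 (key.trans (mul_one _).symm)
  exact this

def gtaJoin {d : ℕ} (I : Finset (Fin d)) (y : ↥I → ℝ) (z : {i // ¬ i ∈ I} → ℝ) : Fin d → ℝ :=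
  fun i => if h : i ∈ I then y ⟨i, h⟩ else z ⟨i, h⟩

lemma gta_dot_join {d : ℕ} (I : Finset (Fin d)) (y : ↥I → ℝ) (z : {i // ¬ i ∈ I} → ℝ)
    (f : Fin d → ℝ) : f ⬝ᵥ gtaJoin I y z = (fun i : ↥I => f i) ⬝ᵥ y +
      (fun i : {i // ¬ i ∈ I} => f i) ⬝ᵥ z := by
  simp only [dotProduct]
  rw [← Fintype.sum_subtype_add_sum_subtype (fun i => i ∈ I) (fun i => f i * gtaJoin I y z i)]
  congr 1
  · exact Finset.sum_congr (by ext; simp) fun i _ => by simp [gtaJoin]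
  · exact Finset.sum_congr rfl fun i _ => by simp [gtaJoin, i.2]

lemma gta_subM_posDef {d : ℕ} (A : Matrix (Fin d) (Fin d) ℝ) (hA : A.PosDef) (I : Finset (Fin d)) :
    (subM A I I).PosDef :=
  hA.submatrix (e := fun i : ↥I => (i : Fin d)) Subtype.val_injective

def gtaShift {d : ℕ} (A : Matrix (Fin d) (Fin d) ℝ) (I : Finset (Fin d)) (y : ↥I → ℝ) :
    {i // ¬ i ∈ I} → ℝ :=
  fun j => A.mulVec (gtaJoin I ((subM A I I)⁻¹.mulVec y) 0) j

lemma gta_quad {d : ℕ} (A : Matrix (Fin d) (Fin d) ℝ) (hA : A.PosDef) (I : Finset (Fin d))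
    (y : ↥I → ℝ) (z : {i // ¬ i ∈ I} → ℝ) :
    gtaJoin I y (z + gtaShift A I y) ⬝ᵥ A⁻¹.mulVec (gtaJoin I y (z + gtaShift A I y)) =
      y ⬝ᵥ (subM A I I)⁻¹.mulVec y + gtaJoin I 0 z ⬝ᵥ A⁻¹.mulVec (gtaJoin I 0 z) := by
  have hAu : IsUnit A.det := hA.det_pos.ne'.isUnit
  have hSu : IsUnit (subM A I I).det := (gta_subM_posDef A hA I).det_pos.ne'.isUnit
  set v := (subM A I I)⁻¹.mulVec y with hv
  set p := gtaJoin I v 0 with hp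
  set q := gtaJoin I 0 z with hq
  have hSv : (subM A I I).mulVec v = y := by
    rw [hv, Matrix.mulVec_mulVec, Matrix.mul_nonsing_inv _ hSu, Matrix.one_mulVec]
  have hAp : ∀ i : ↥I, A.mulVec p i = y i := by
    intro i
    have h1 : A.mulVec p i = (A i) ⬝ᵥ p := rfl
    rw [h1, hp, gta_dot_join, dotProduct_zero, add_zero]
    exact congrFun hSv i
  have hj : gtaJoin I y (z + gtaShift A I y) = A.mulVec p + q := by
    ext i
    by_cases hi : i ∈ I
    · simp [gtaJoin, hi, hq, hAp ⟨i, hi⟩]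
    · simp [gtaJoin, hi, hq, gtaShift, ← hv, ← hp, add_comm]
  have hpq : p ⬝ᵥ q = 0 := by
    rw [hq, gta_dot_join]
    have : (fun i : {i // ¬ i ∈ I} => p i) = 0 := by
      ext i; simp [hp, gtaJoin, i.2]
    rw [this]; simp
  have hpAp : A.mulVec p ⬝ᵥ p = y ⬝ᵥ v := by
    rw [show A.mulVec p ⬝ᵥ p = A.mulVec p ⬝ᵥ gtaJoin I v 0 from rfl, gta_dot_join, dotProduct_zero, add_zero]
    congr 1
    ext i; exact hAp i
  have hsym : A⁻¹ᵀ = A⁻¹ := by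
    have := hA.inv.1
    simpa [Matrix.IsHermitian] using this
  have hAA : A⁻¹.mulVec (A.mulVec p) = p := by
    rw [Matrix.mulVec_mulVec, Matrix.nonsing_inv_mul _ hAu, Matrix.one_mulVec]
  have hcross : A.mulVec p ⬝ᵥ A⁻¹.mulVec q = 0 := by
    rw [Matrix.dotProduct_mulVec, ← Matrix.mulVec_transpose, hsym, hAA, hpq]
  rw [hj, Matrix.mulVec_add, hAA, add_dotProduct, dotProduct_add, dotProduct_add, hpAp, hcross,
    dotProduct_comm q p, hpq]
  ring

lemma gta_marg0 {d : ℕ} (A : Matrix (Fin d) (Fin d) ℝ) (hA : A.PosDef) (I : Finset (Fin d))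
    (B : Set (↥I → ℝ)) (hB : MeasurableSet B) :
    ∫⁻ x in {x : Fin d → ℝ | (fun i : ↥I => x i) ∈ B}, ENNReal.ofReal (gaussPDF A x) =
      (∫⁻ z : {i // ¬ i ∈ I} → ℝ, ENNReal.ofReal (gaussPDF A (gtaJoin I 0 z))) *
      ∫⁻ y in B, ENNReal.ofReal (Real.exp (-(y ⬝ᵥ (subM A I I)⁻¹.mulVec y) / 2)) := by
  have hr : Measurable fun x : Fin d → ℝ => (fun i : ↥I => x i) := by fun_prop
  have hBm : MeasurableSet {x : Fin d → ℝ | (fun i : ↥I => x i) ∈ B} := hr hB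
  have hg : Measurable fun x => ENNReal.ofReal (gaussPDF A x) :=
    (gta_pdf_cont A).measurable.ennreal_ofReal
  have hE : Measurable fun y : ↥I → ℝ => ENNReal.ofReal (Real.exp (-(y ⬝ᵥ (subM A I I)⁻¹.mulVec y) / 2)) := by
    have := gta_quad_cont (subM A I I)⁻¹
    exact Measurable.ennreal_ofReal (by fun_prop)
  have hmp : MeasurePreserving (fun w : (↥I → ℝ) × ({i // ¬ i ∈ I} → ℝ) => gtaJoin I w.1 w.2)
      (volume.prod volume) volume := by
    have h0 := (volume_preserving_piEquivPiSubtypeProd (fun _ : Fin d => ℝ) (fun i => i ∈ I)).symm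
    convert! h0 using 1
    change _ = Measure.prod _ _
    congr!
  rw [← lintegral_indicator hBm, ← hmp.lintegral_comp (hg.indicator hBm)]
  rw [← lintegral_indicator hB, ← lintegral_const_mul _ (hE.indicator hB)]
  refine (lintegral_prod _ (((hg.indicator hBm).comp hmp.measurable).aemeasurable)).trans ?_
  simp only [Function.comp_apply]
  refine lintegral_congr fun y => ?_
  have hmem : ∀ z, gtaJoin I y z ∈ {x : Fin d → ℝ | (fun i : ↥I => x i) ∈ B} ↔ y ∈ B := by
    intro z
    have : (fun i : ↥I => gtaJoin I y z i) = y := by ext i; simp [gtaJoin]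
    simp [this]
  by_cases hy : y ∈ B
  · simp only [Set.indicator, hmem, hy, if_true]
    rw [← lintegral_add_right_eq_self _ (gtaShift A I y), ← lintegral_mul_const' _ _ ENNReal.ofReal_ne_top]
    refine lintegral_congr fun z => ?_
    rw [← ENNReal.ofReal_mul (by unfold gaussPDF; positivity)]
    congr 1
    unfold gaussPDF
    rw [gta_quad A hA, mul_assoc, ← Real.exp_add]
    congr 2
    ring
  · simp only [Set.indicator, hmem, hy, if_false]
    simp

lemma gta_marg {Ω : Type*} [MeasurableSpace Ω] (P : Measure Ω) [IsProbabilityMeasure P]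
    {d : ℕ} (A : Matrix (Fin d) (Fin d) ℝ) (hA : A.PosDef)
    (X : Ω → Fin d → ℝ) (hX : Measurable X) (hG : IsCenteredGaussianRV P X A) (I : Finset (Fin d))
    (B : Set (↥I → ℝ)) (hB : MeasurableSet B) :
    P {ω | (fun i : ↥I => X ω i) ∈ B} = ∫⁻ y in B, ENNReal.ofReal (gaussPDF (subM A I I) y) := by
  have hr : Measurable fun x : Fin d → ℝ => (fun i : ↥I => x i) := by fun_prop
  set K := (∫⁻ z : {i // ¬ i ∈ I} → ℝ, ENNReal.ofReal (gaussPDF A (gtaJoin I 0 z))) with hK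
  set F := fun y : ↥I → ℝ => ENNReal.ofReal (Real.exp (-(y ⬝ᵥ (subM A I I)⁻¹.mulVec y) / 2)) with hF
  have h1 : ∀ B : Set (↥I → ℝ), MeasurableSet B →
      P {ω | (fun i : ↥I => X ω i) ∈ B} = K * ∫⁻ y in B, F y := by
    intro B hB
    have hBm : MeasurableSet {x : Fin d → ℝ | (fun i : ↥I => x i) ∈ B} := hr hB
    rw [hK, hF, ← gta_marg0 A hA I B hB, ← withDensity_apply _ hBm, ← hG, Measure.map_apply hX hBm]
    rfl
  set N := ENNReal.ofReal ((√((2 * Real.pi) ^ Fintype.card ↥I * (subM A I I).det))⁻¹) with hN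
  have hpdf : ∀ y, ENNReal.ofReal (gaussPDF (subM A I I) y) = N * F y := by
    intro y
    rw [hN, hF, ← ENNReal.ofReal_mul (by positivity)]; rfl
  have h2 := h1 Set.univ MeasurableSet.univ
  have h3 := gta_norm _ (gta_subM_posDef A hA I)
  simp_rw [hpdf] at h3 ⊢
  have hNt : N ≠ ⊤ := ENNReal.ofReal_ne_top
  rw [lintegral_const_mul' _ _ hNt] at h3 ⊢
  simp only [Set.mem_univ, Set.ofPred_true, measure_univ, Measure.restrict_univ] at h2
  have hF0 : ∫⁻ y, F y ≠ 0 := fun h => by rw [h] at h3; simp at h3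
  have hN0 : N ≠ 0 := fun h => by rw [h] at h3; simp at h3
  have hFt : ∫⁻ y, F y ≠ ⊤ := fun h => by rw [h, ENNReal.mul_top hN0] at h3; simp at h3
  have : K = N := (ENNReal.mul_left_inj hF0 hFt).1 (h2.symm.trans h3.symm)
  rw [h1 B hB, this]

lemma gta_exp_int {ι : Type*} [Fintype ι] (b : ι → ℝ) (hb : ∀ i, 0 < b i) :
    IntegrableOn (fun z : ι → ℝ => ∏ i, Real.exp (-(b i) * z i)) (Set.pi Set.univ fun _ => Set.Ioi 0) ∧
    ∫ z in (Set.pi Set.univ fun _ : ι => Set.Ioi (0 : ℝ)), ∏ i, Real.exp (-(b i) * z i) = ∏ i, (b i)⁻¹ := by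
  have hr : (volume : Measure (ι → ℝ)).restrict (Set.pi Set.univ fun _ => Set.Ioi 0) =
      Measure.pi fun _ => (volume : Measure ℝ).restrict (Set.Ioi 0) :=
    Measure.restrict_pi_pi _ _
  unfold IntegrableOn
  rw [hr]
  constructor
  · exact Integrable.fintype_prod (f := fun i x => Real.exp (-(b i) * x))
      (fun i => exp_neg_integrableOn_Ioi 0 (hb i))
  · rw [integral_fintype_prod_eq_prod (fun i x => Real.exp (-(b i) * x))]
    refine Finset.prod_congr rfl fun i _ => ?_
    rw [integral_exp_mul_Ioi (by linarith [hb i])]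
    have := (hb i).ne'
    simp

lemma gta_symm {ι : Type*} [Fintype ι] [DecidableEq ι] (S : Matrix ι ι ℝ) (hS : S.PosDef) :
    S⁻¹ᵀ = S⁻¹ := by
  have := hS.inv.1
  simpa [Matrix.IsHermitian] using this

lemma gta_pdf_shift {ι : Type*} [Fintype ι] [DecidableEq ι] (S : Matrix ι ι ℝ) (hS : S.PosDef)
    (t z : ι → ℝ) (u : ℝ) :
    gaussPDF S (u⁻¹ • z + t) = gaussPDF S t *
      Real.exp (-(z ⬝ᵥ S⁻¹.mulVec (u⁻¹ • t)) - u⁻¹ ^ 2 * (z ⬝ᵥ S⁻¹.mulVec z) / 2) := by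
  unfold gaussPDF
  rw [mul_assoc, ← Real.exp_add]
  congr 2
  have hc : t ⬝ᵥ S⁻¹.mulVec z = z ⬝ᵥ S⁻¹.mulVec t := by
    rw [Matrix.dotProduct_mulVec, ← Matrix.mulVec_transpose, gta_symm S hS, dotProduct_comm]
  simp only [Matrix.mulVec_add, add_dotProduct, dotProduct_add, Matrix.mulVec_smul, smul_dotProduct,
    dotProduct_smul, smul_eq_mul, hc]
  ring

lemma gta_dct {ι : Type*} [Fintype ι] [DecidableEq ι] (S : Matrix ι ι ℝ) (hS : S.PosDef)
    (c : ι → ℝ) (hb : ∀ i, 0 < S⁻¹.mulVec c i) (t : ℝ → ι → ℝ)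
    (ht : Tendsto (fun u => u⁻¹ • t u) atTop (𝓝 c)) :
    Tendsto (fun u : ℝ => ∫ z in (Set.pi Set.univ fun _ : ι => Set.Ioi (0 : ℝ)),
      Real.exp (-(z ⬝ᵥ S⁻¹.mulVec (u⁻¹ • t u)) - u⁻¹ ^ 2 * (z ⬝ᵥ S⁻¹.mulVec z) / 2)) atTop
      (𝓝 (∏ i, (S⁻¹.mulVec c i)⁻¹)) := by
  have hsm : MeasurableSet (Set.pi Set.univ fun _ : ι => Set.Ioi (0 : ℝ)) :=
    MeasurableSet.univ_pi fun _ => measurableSet_Ioi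
  rw [← (gta_exp_int _ hb).2]
  have hprod : ∀ (a z : ι → ℝ), ∏ i, Real.exp (-(a i) * z i) = Real.exp (-(z ⬝ᵥ a)) := by
    intro a z
    rw [← Real.exp_sum]
    congr 1
    simp only [dotProduct]
    rw [← Finset.sum_neg_distrib]
    exact Finset.sum_congr rfl fun i _ => by ring
  have hMt : Tendsto (fun u => S⁻¹.mulVec (u⁻¹ • t u)) atTop (𝓝 (S⁻¹.mulVec c)) := by
    have : Continuous fun v : ι → ℝ => S⁻¹.mulVec v :=
      Continuous.matrix_mulVec continuous_const continuous_id
    exact (this.tendsto c).comp ht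
  have hb2 : ∀ i, 0 < S⁻¹.mulVec c i / 2 := fun i => half_pos (hb i)
  refine tendsto_integral_filter_of_dominated_convergence
    (fun z => ∏ i, Real.exp (-(S⁻¹.mulVec c i / 2) * z i)) ?_ ?_ (gta_exp_int _ hb2).1 ?_
  · refine Eventually.of_forall fun u => Continuous.aestronglyMeasurable ?_
    have h1 := gta_quad_cont S⁻¹
    have h2 : Continuous fun z : ι → ℝ => z ⬝ᵥ S⁻¹.mulVec (u⁻¹ • t u) :=
      Continuous.dotProduct continuous_id continuous_const
    fun_prop
  · have hev : ∀ᶠ u in atTop, ∀ i, S⁻¹.mulVec c i / 2 < S⁻¹.mulVec (u⁻¹ • t u) i := by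
      rw [eventually_all]
      intro i
      exact ((tendsto_pi_nhds.1 hMt) i).eventually (lt_mem_nhds (half_lt_self (hb i)))
    filter_upwards [hev] with u hu
    filter_upwards [ae_restrict_mem hsm] with z hz
    rw [hprod (fun i => S⁻¹.mulVec c i / 2), Real.norm_eq_abs, Real.abs_exp, Real.exp_le_exp]
    have hq : 0 ≤ z ⬝ᵥ S⁻¹.mulVec z := by
      have := hS.inv.posSemidef.dotProduct_mulVec_nonneg z
      simpa using this
    have hle : z ⬝ᵥ (fun i => S⁻¹.mulVec c i / 2) ≤ z ⬝ᵥ S⁻¹.mulVec (u⁻¹ • t u) := by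
      refine Finset.sum_le_sum fun i _ => ?_
      exact mul_le_mul_of_nonneg_left (hu i).le (le_of_lt (hz i trivial))
    have : 0 ≤ u⁻¹ ^ 2 * (z ⬝ᵥ S⁻¹.mulVec z) := mul_nonneg (sq_nonneg _) hq
    linarith
  · refine Eventually.of_forall fun z => ?_
    rw [hprod]
    refine (Real.continuous_exp.tendsto _).comp ?_
    have h1 : Tendsto (fun u : ℝ => z ⬝ᵥ S⁻¹.mulVec (u⁻¹ • t u)) atTop (𝓝 (z ⬝ᵥ S⁻¹.mulVec c)) := by
      have : Continuous fun v : ι → ℝ => z ⬝ᵥ v := Continuous.dotProduct continuous_const continuous_id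
      exact (this.tendsto _).comp hMt
    have h2 : Tendsto (fun u : ℝ => u⁻¹ ^ 2 * (z ⬝ᵥ S⁻¹.mulVec z) / 2) atTop (𝓝 0) := by
      have := ((tendsto_inv_atTop_zero (𝕜 := ℝ)).pow 2).mul_const (z ⬝ᵥ S⁻¹.mulVec z / 2)
      simpa [mul_div_assoc] using this
    simpa using h1.neg.sub h2

lemma gta_scale {ι : Type*} [Fintype ι] [DecidableEq ι] (S : Matrix ι ι ℝ) (hS : S.PosDef)
    (t : ι → ℝ) (u : ℝ) (hu : 0 < u) :
    u ^ Fintype.card ι * (∫⁻ y in {y : ι → ℝ | ∀ i, t i < y i}, ENNReal.ofReal (gaussPDF S y)).toReal =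
    gaussPDF S t * ∫ z in (Set.pi Set.univ fun _ : ι => Set.Ioi (0 : ℝ)),
      Real.exp (-(z ⬝ᵥ S⁻¹.mulVec (u⁻¹ • t)) - u⁻¹ ^ 2 * (z ⬝ᵥ S⁻¹.mulVec z) / 2) := by
  have hsm : MeasurableSet (Set.pi Set.univ fun _ : ι => Set.Ioi (0 : ℝ)) :=
    MeasurableSet.univ_pi fun _ => measurableSet_Ioi
  have htm : MeasurableSet {y : ι → ℝ | ∀ i, t i < y i} := by
    have : {y : ι → ℝ | ∀ i, t i < y i} = Set.pi Set.univ fun i => Set.Ioi (t i) := by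
      ext y; simp
    rw [this]
    exact MeasurableSet.univ_pi fun _ => measurableSet_Ioi
  rw [← integral_eq_lintegral_of_nonneg_ae (Eventually.of_forall fun y => by
    change 0 ≤ gaussPDF S y
    unfold gaussPDF; positivity) (gta_pdf_cont S).aestronglyMeasurable]
  rw [← integral_const_mul (gaussPDF S t), ← integral_indicator htm, ← integral_indicator hsm,
    ← integral_add_right_eq_self _ t]
  have h := Measure.integral_comp_smul (volume : Measure (ι → ℝ))
    (fun y => {y : ι → ℝ | ∀ i, t i < y i}.indicator (gaussPDF S) (y + t)) u⁻¹
  have habs : |((u⁻¹ ^ Module.finrank ℝ (ι → ℝ))⁻¹)| = u ^ Fintype.card ι := by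
    rw [Module.finrank_fintype_fun_eq_card, inv_pow, inv_inv, abs_of_pos (by positivity)]
  rw [habs, smul_eq_mul] at h
  rw [← h]
  refine integral_congr_ae (Eventually.of_forall fun z => ?_)
  have hiff : (u⁻¹ • z + t ∈ {y : ι → ℝ | ∀ i, t i < y i}) ↔
      z ∈ Set.pi Set.univ fun _ : ι => Set.Ioi (0 : ℝ) := by
    simp [hu]
  simp only [Set.indicator, gta_pdf_shift S hS t z u]
  by_cases hz : z ∈ Set.pi Set.univ fun _ : ι => Set.Ioi (0 : ℝ)
  · rw [if_pos hz, if_pos (hiff.2 hz)]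
  · rw [if_neg hz, if_neg (fun h => hz (hiff.1 h))]

/-- Lemma 4.2, equation (sh): with `I` the index set of `Π_Σ(c)` (of cardinality `m`)
and `x(u)/u → 0`, one has, as `u → ∞`,
`P(X_I > (cu + x(u))_I) ~ u^{-m} φ_{X_I}((cu+x(u))_I) / ∏_{i∈I} c_I^⊤(Σ_II)⁻¹e_i`. -/
theorem gaussian_tail_asymptotics
    {Ω : Type*} [MeasurableSpace Ω] (P : Measure Ω) [IsProbabilityMeasure P]
    {d : ℕ} (A : Matrix (Fin d) (Fin d) ℝ) (hA : A.PosDef)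
    (X : Ω → Fin d → ℝ) (hX : Measurable X) (hG : IsCenteredGaussianRV P X A)
    (c : Fin d → ℝ) (hc : ∃ i, 0 < c i)
    (bt : Fin d → ℝ) (I : Finset (Fin d))
    (hsol : IsQPSol A c bt) (hI : IsQPIndex A c bt I)
    (x : ℝ → Fin d → ℝ) (hx : ∀ i, Tendsto (fun u => x u i / u) atTop (𝓝 0)) :
    Tendsto (fun u =>
        (P {ω | ∀ i ∈ I, c i * u + x u i < X ω i}).toReal /
          ((u ^ I.card)⁻¹ *
            gaussPDF (subM A I I) (fun i : ↥I => c (i : Fin d) * u + x u (i : Fin d)) /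
            ∏ i : ↥I, subV c I ⬝ᵥ (subM A I I)⁻¹.mulVec (Pi.single i 1)))
      atTop (𝓝 1) := by
  obtain ⟨-, -, hb, -⟩ := hI
  set S := subM A I I with hSdef
  have hS : S.PosDef := gta_subM_posDef A hA I
  set t : ℝ → ↥I → ℝ := fun u i => c (i : Fin d) * u + x u (i : Fin d) with htdef
  have ht : Tendsto (fun u => u⁻¹ • t u) atTop (𝓝 (subV c I)) := by
    rw [tendsto_pi_nhds]
    intro i
    have h1 : Tendsto (fun u => c i + x u i / u) atTop (𝓝 (c i + 0)) := (hx i).const_add _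
    rw [add_zero] at h1
    refine h1.congr' ?_
    filter_upwards [eventually_gt_atTop 0] with u hu
    simp only [htdef, Pi.smul_apply, smul_eq_mul]
    field_simp
  have hdct := gta_dct S hS (subV c I) hb t ht
  have hprod : ∀ i : ↥I, subV c I ⬝ᵥ S⁻¹.mulVec (Pi.single i 1) = S⁻¹.mulVec (subV c I) i := by
    intro i
    rw [Matrix.dotProduct_mulVec, ← Matrix.mulVec_transpose, gta_symm S hS, dotProduct_single_one]
  simp_rw [hprod]
  have hpos : 0 < ∏ i : ↥I, S⁻¹.mulVec (subV c I) i := Finset.prod_pos fun i _ => hb i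
  have hlim := hdct.const_mul (∏ i : ↥I, S⁻¹.mulVec (subV c I) i)
  rw [Finset.prod_inv_distrib, mul_inv_cancel₀ hpos.ne'] at hlim
  refine hlim.congr' ?_
  filter_upwards [eventually_gt_atTop 0] with u hu
  have htm : MeasurableSet {y : ↥I → ℝ | ∀ i, t u i < y i} := by
    have : {y : ↥I → ℝ | ∀ i, t u i < y i} = Set.pi Set.univ fun i => Set.Ioi (t u i) := by
      ext y; simp
    rw [this]
    exact MeasurableSet.univ_pi fun _ => measurableSet_Ioi
  have hP : P {ω | ∀ i ∈ I, c i * u + x u i < X ω i} =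
      ∫⁻ y in {y : ↥I → ℝ | ∀ i, t u i < y i}, ENNReal.ofReal (gaussPDF S y) := by
    rw [← gta_marg P A hA X hX hG I _ htm]
    congr 1
    ext ω
    simp [htdef]
  rw [hP]
  have hsc := gta_scale S hS (t u) u hu
  rw [Fintype.card_coe] at hsc
  have hg : 0 < gaussPDF S (t u) := by
    have := hS.det_pos
    unfold gaussPDF
    positivity
  have hup : 0 < u ^ I.card := by positivity
  change _ = _ / (_ * gaussPDF S (t u) / _)
  generalize gaussPDF S (t u) = G at hsc hg ⊢
  generalize (∫⁻ y in {y : ↥I → ℝ | ∀ i, t u i < y i}, ENNReal.ofReal (gaussPDF S y)).toReal = Q at hsc ⊢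
  generalize ∏ i : ↥I, S⁻¹.mulVec (subV c I) i = R at hpos ⊢
  generalize u ^ I.card = U at hsc hup ⊢
  generalize (∫ z in (Set.pi Set.univ fun _ : ↥I => Set.Ioi (0 : ℝ)), Real.exp (-(z ⬝ᵥ S⁻¹.mulVec (u⁻¹ • t u)) - u⁻¹ ^ 2 * (z ⬝ᵥ S⁻¹.mulVec z) / 2)) = J at hsc ⊢
  rw [eq_div_iff (by positivity)]
  field_simp
  rw [hsc, mul_comm]
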